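/- arXiv:1101.4542 — 6 statements merged into one kernel-verified Lean document; each statement's English description precedes it below -/
import Mathlib

section
/- Let ω be a bivector in the exterior algebra of ℝ⁴, i.e. an element of the square of the submodule (ExteriorAlgebra.ι ℝ).range inside ⋀(Fin 4 → ℝ). Then ω is simple (decomposable), i.e. there exist vectors a, b ∈ ℝ⁴ with ω = ι(a) * ι(b), if and only if ω * ω = 0. -/
namespace ExteriorAlgebra

section CommRing

variable {R M : Type*} [CommRing R] [AddCommGroup M] [Module R M]

theorem ι_mul_ι_swap (x y : M) : ι R y * ι R x = -(ι R x * ι R y) :=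
  eq_neg_of_add_eq_zero_left (ι_add_mul_swap y x)

theorem ι_mul_ι_mul_swap (x y : M) (v : ExteriorAlgebra R M) :
    ι R y * (ι R x * v) = -(ι R x * (ι R y * v)) := by
  rw [← mul_assoc, ι_mul_ι_swap, neg_mul, mul_assoc]

theorem ι_mul_ι_mul_self (x : M) (v : ExteriorAlgebra R M) : ι R x * (ι R x * v) = 0 := by
  rw [← mul_assoc, ι_sq_zero, zero_mul]

theorem ι_mul_ι_mul_ι_mul_ι_self (a b : M) :
    (ι R a * ι R b) * (ι R a * ι R b) = 0 := by
  rw [mul_assoc, ι_mul_ι_mul_swap a b, mul_neg, ι_mul_ι_mul_self, neg_zero]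

/-- The bivector with the given Plücker coordinates with respect to four vectors. -/
def bivector (x y z w : M) (p q r s t u : R) : ExteriorAlgebra R M :=
  p • (ι R x * ι R y) + q • (ι R x * ι R z) + r • (ι R x * ι R w) +
    s • (ι R y * ι R z) + t • (ι R y * ι R w) + u • (ι R z * ι R w)

theorem bivector_mul_self (x y z w : M) (p q r s t u : R) :
    bivector x y z w p q r s t u * bivector x y z w p q r s t u =
      (2 * (p * u - q * t + r * s)) • (ι R x * (ι R y * (ι R z * ι R w))) := by
  simp only [bivector, mul_add, add_mul, smul_mul_smul_comm, mul_assoc,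
    ι_mul_ι_swap y z, ι_mul_ι_swap y w, ι_mul_ι_swap z w, ι_mul_ι_mul_swap x y, ι_mul_ι_mul_swap x z, ι_mul_ι_mul_swap x w,
    ι_mul_ι_mul_swap y z, ι_mul_ι_mul_swap y w, ι_mul_ι_mul_swap z w, ι_mul_ι_mul_self,
    ι_sq_zero, mul_neg, mul_zero, neg_zero, smul_zero]
  module

end CommRing

section Field

variable {K V : Type*} [Field K] [AddCommGroup V] [Module K V]

theorem exists_bivector_eq_ι_mul_ι_of_ne_zero (x y z w : V) {p q r s t u : K} (hp : p ≠ 0)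
    (h : p * u - q * t + r * s = 0) :
    ∃ a b : V, bivector x y z w p q r s t u = ι K a * ι K b := by
  refine ⟨x - (p⁻¹ * s) • z - (p⁻¹ * t) • w, p • y + q • z + r • w, ?_⟩
  have hu : u = p⁻¹ * (q * t - r * s) := by
    field_simp
    linear_combination h
  simp only [bivector, map_add, map_sub, map_smul, mul_add, sub_mul,
    smul_mul_assoc, mul_smul_comm, ι_mul_ι_swap y z, ι_mul_ι_swap y w, ι_mul_ι_swap z w,
    ι_sq_zero, smul_zero, hu]
  match_scalars <;> field_simp
  ring

/-- A bivector satisfying the Plücker relation is simple. -/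
theorem exists_bivector_eq_ι_mul_ι (x y z w : V) {p q r s t u : K}
    (h : p * u - q * t + r * s = 0) :
    ∃ a b : V, bivector x y z w p q r s t u = ι K a * ι K b := by
  by_cases hp : p ≠ 0
  · exact exists_bivector_eq_ι_mul_ι_of_ne_zero x y z w hp h
  by_cases hq : q ≠ 0
  · convert exists_bivector_eq_ι_mul_ι_of_ne_zero x z y w (q := p) (r := r) (s := -s) (t := u)
      (u := t) hq (by linear_combination -h) using 5
    simp only [bivector, ι_mul_ι_swap y z]
    module
  by_cases hr : r ≠ 0
  · convert exists_bivector_eq_ι_mul_ι_of_ne_zero x w y z (q := p) (r := q) (s := -t) (t := -u)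
      (u := s) hr (by linear_combination h) using 5
    simp only [bivector, ι_mul_ι_swap y w, ι_mul_ι_swap z w]
    module
  by_cases hs : s ≠ 0
  · convert exists_bivector_eq_ι_mul_ι_of_ne_zero y z x w (q := -p) (r := t) (s := -q) (t := u)
      (u := r) hs (by linear_combination h) using 5
    simp only [bivector, ι_mul_ι_swap x y, ι_mul_ι_swap x z]
    module
  by_cases ht : t ≠ 0
  · convert exists_bivector_eq_ι_mul_ι_of_ne_zero y w x z (q := -p) (r := s) (s := -r) (t := -u)
      (u := q) ht (by linear_combination -h) using 5
    simp only [bivector, ι_mul_ι_swap x y, ι_mul_ι_swap x w, ι_mul_ι_swap z w]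
    module
  push Not at hp hq hr hs ht
  refine ⟨u • z, w, ?_⟩
  simp [bivector, hp, hq, hr, hs, ht]

end Field

theorem exists_eq_bivector_of_mem {R : Type*} [CommRing R] {ω : ExteriorAlgebra R (Fin 4 → R)}
    (hω : ω ∈ LinearMap.range (ι R (M := Fin 4 → R)) ^ 2) :
    ∃ p q r s t u : R, ω = bivector (Pi.single 0 1) (Pi.single 1 1) (Pi.single 2 1)
      (Pi.single 3 1) p q r s t u := by
  rw [pow_two] at hω
  induction hω using Submodule.mul_induction_on' with
  | mem_mul_mem m hm n hn =>
    obtain ⟨a, rfl⟩ := hm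
    obtain ⟨b, rfl⟩ := hn
    refine ⟨a 0 * b 1 - a 1 * b 0, a 0 * b 2 - a 2 * b 0, a 0 * b 3 - a 3 * b 0,
      a 1 * b 2 - a 2 * b 1, a 1 * b 3 - a 3 * b 1, a 2 * b 3 - a 3 * b 2, ?_⟩
    conv_lhs => rw [pi_eq_sum_univ' a, pi_eq_sum_univ' b]
    simp only [Fin.sum_univ_four]
    generalize (Pi.single 0 1 : Fin 4 → R) = x
    generalize (Pi.single 1 1 : Fin 4 → R) = y
    generalize (Pi.single 2 1 : Fin 4 → R) = z
    generalize (Pi.single 3 1 : Fin 4 → R) = w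
    simp only [bivector, map_add, map_smul, mul_add, add_mul, smul_mul_smul_comm,
      ι_mul_ι_swap x y, ι_mul_ι_swap x z, ι_mul_ι_swap x w, ι_mul_ι_swap y z, ι_mul_ι_swap y w,
      ι_mul_ι_swap z w, ι_sq_zero]
    module
  | add m _ n _ ihm ihn =>
    obtain ⟨p, q, r, s, t, u, rfl⟩ := ihm
    obtain ⟨p', q', r', s', t', u', rfl⟩ := ihn
    refine ⟨p + p', q + q', r + r', s + s', t + t', u + u', ?_⟩
    simp only [bivector]
    module

theorem ιMulti_single_ne_zero (R : Type*) [CommRing R] [Nontrivial R] (n : ℕ) :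
    ιMulti R n (fun i : Fin n => (Pi.single i 1 : Fin n → R)) ≠ 0 := by
  intro h
  have key := liftAlternating_apply_ιMulti (R := R)
    (Function.update 0 n (Matrix.detRowAlternating (n := Fin n) (R := R)))
    (fun i : Fin n => (Pi.single i 1 : Fin n → R))
  have h1 : (fun i : Fin n => (Pi.single i 1 : Fin n → R)) = (1 : Matrix (Fin n) (Fin n) R) := by
    ext i j
    rw [Matrix.one_apply, Pi.single_apply]
    simp only [eq_comm]
  rw [h, map_zero, Function.update_self, h1] at key
  exact zero_ne_one (key.trans Matrix.det_one)

end ExteriorAlgebra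

open ExteriorAlgebra in
/-- A bivector in the exterior algebra of `ℝ⁴` (an element of the square of the submodule
of 1-vectors) is simple (decomposable as a wedge of two vectors) iff its square is zero. -/
theorem bivector_simple_iff_sq_eq_zero
    (ω : ExteriorAlgebra ℝ (Fin 4 → ℝ))
    (hω : ω ∈ (LinearMap.range (ExteriorAlgebra.ι ℝ (M := Fin 4 → ℝ)) ^ 2 :
      Submodule ℝ (ExteriorAlgebra ℝ (Fin 4 → ℝ)))) :
    (∃ a b : Fin 4 → ℝ, ω = ExteriorAlgebra.ι ℝ a * ExteriorAlgebra.ι ℝ b) ↔ ω * ω = 0 := by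
  constructor
  · rintro ⟨a, b, rfl⟩
    exact ι_mul_ι_mul_ι_mul_ι_self a b
  · intro h
    obtain ⟨p, q, r, s, t, u, rfl⟩ := exists_eq_bivector_of_mem hω
    rw [bivector_mul_self, smul_eq_zero] at h
    refine exists_bivector_eq_ι_mul_ι _ _ _ _ ?_
    rcases h with h | h
    · simpa using h
    · refine absurd ?_ (ιMulti_single_ne_zero ℝ 4)
      simp only [ιMulti_apply, List.ofFn_succ, List.ofFn_zero, List.prod_cons, List.prod_nil,
        mul_one]
      exact h
end

section
/- Work in the Clifford algebra Cl(2,0,1). Let a₀, a₁, a₂, x, y ∈ ℝ with a₁² + a₂² = 1, let a := a₀·ι(e₀) + a₁·ι(e₁) + a₂·ι(e₂) (a normalized line), and let d := a₁x + a₂y + a₀. Then a * P(x,y) * a = -P(x - 2·d·a₁, y - 2·d·a₂); that is, the sandwich X ↦ aXa maps the point (x,y) to (minus, i.e. with reversed orientation) the point obtained by euclidean reflection of (x,y) in the line a₀ + a₁x + a₂y = 0. -/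
noncomputable section

/-- The quadratic form of signature (2,0,1) on `ℝ³` (plane-based model of the euclidean
plane): `Q (x₀,x₁,x₂) = x₁² + x₂²`. -/
def Q201 : QuadraticForm ℝ (Fin 3 → ℝ) := QuadraticMap.weightedSumSquares ℝ ![0, 1, 1]

/-- The canonical embedding of vectors into `Cl(2,0,1)`. -/
def ι2 : (Fin 3 → ℝ) →ₗ[ℝ] CliffordAlgebra Q201 := CliffordAlgebra.ι Q201

/-- The standard basis vectors `e₀, e₁, e₂` of `ℝ³`. -/
def eV (i : Fin 3) : Fin 3 → ℝ := Pi.single i 1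

/-- Basis bivector `E₀ = e₁e₂`. -/
def E₀ : CliffordAlgebra Q201 := ι2 (eV 1) * ι2 (eV 2)

/-- Basis bivector `E₁ = e₂e₀`. -/
def E₁ : CliffordAlgebra Q201 := ι2 (eV 2) * ι2 (eV 0)

/-- Basis bivector `E₂ = e₀e₁`. -/
def E₂ : CliffordAlgebra Q201 := ι2 (eV 0) * ι2 (eV 1)

/-- The euclidean point `(x,y)` as a normalized bivector of `Cl(2,0,1)`. -/
def Pt (x y : ℝ) : CliffordAlgebra Q201 := E₀ + x • E₁ + y • E₂

/-- In an algebra where `u, v, w` pairwise anticommute and square to `0, 1, 1`, sandwiching the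
bivector of a point by a normalized line gives minus the bivector of the reflected point. -/
theorem sandwich_of_anticommute {A : Type*} [Ring A] [Algebra ℝ A] {u v w : A}
    (huu : u * u = 0) (hvv : v * v = 1) (hww : w * w = 1)
    (hvu : v * u = -(u * v)) (hwu : w * u = -(u * w)) (hwv : w * v = -(v * w))
    (a₀ a₁ a₂ x y : ℝ) (h : a₁ ^ 2 + a₂ ^ 2 = 1) :
    (a₀ • u + a₁ • v + a₂ • w) * (v * w + x • (w * u) + y • (u * v)) *
        (a₀ • u + a₁ • v + a₂ • w) =
      -(v * w + (x - 2 * (a₁ * x + a₂ * y + a₀) * a₁) • (w * u) +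
        (y - 2 * (a₁ * x + a₂ * y + a₀) * a₂) • (u * v)) := by
  have huu' (z : A) : u * (u * z) = 0 := by rw [← mul_assoc, huu, zero_mul]
  have hvv' (z : A) : v * (v * z) = z := by rw [← mul_assoc, hvv, one_mul]
  have hvu' (z : A) : v * (u * z) = -(u * (v * z)) := by
    rw [← mul_assoc, hvu, neg_mul, mul_assoc]
  have hwu' (z : A) : w * (u * z) = -(u * (w * z)) := by
    rw [← mul_assoc, hwu, neg_mul, mul_assoc]
  have hwv' (z : A) : w * (v * z) = -(v * (w * z)) := by
    rw [← mul_assoc, hwv, neg_mul, mul_assoc]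
  simp only [mul_add, add_mul, smul_mul_assoc, mul_smul_comm, mul_assoc, huu, hvv, hww, hvu, hwu,
    hwv, huu', hvv', hvu', hwu', hwv', mul_neg, neg_mul, neg_neg, mul_one, zero_mul,
    smul_neg, smul_zero, neg_zero]
  match_scalars
  all_goals grind

theorem ι2_mul_self (v : Fin 3 → ℝ) : ι2 v * ι2 v = algebraMap ℝ _ (Q201 v) :=
  CliffordAlgebra.ι_sq_scalar Q201 v

theorem ι2_eV_mul_anticomm {i j : Fin 3} (hij : i ≠ j) :
    ι2 (eV i) * ι2 (eV j) = -(ι2 (eV j) * ι2 (eV i)) := by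
  refine CliffordAlgebra.ι_mul_ι_comm_of_isOrtho ?_
  rw [QuadraticMap.isOrtho_def]
  fin_cases i <;> fin_cases j <;>
    simp_all [Q201, eV, QuadraticMap.weightedSumSquares_apply, Fin.sum_univ_three]

/-- Sandwiching the point `(x,y)` by the normalized line `a₀e₀ + a₁e₁ + a₂e₂` yields
minus the reflection of the point in the line `a₀ + a₁x + a₂y = 0`. -/
theorem sandwich_line_is_reflection (a₀ a₁ a₂ x y : ℝ) (h : a₁ ^ 2 + a₂ ^ 2 = 1) :
    (a₀ • ι2 (eV 0) + a₁ • ι2 (eV 1) + a₂ • ι2 (eV 2)) * Pt x y *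
        (a₀ • ι2 (eV 0) + a₁ • ι2 (eV 1) + a₂ • ι2 (eV 2)) =
      -Pt (x - 2 * (a₁ * x + a₂ * y + a₀) * a₁)
          (y - 2 * (a₁ * x + a₂ * y + a₀) * a₂) := by
  have hsq (i : Fin 3) : ι2 (eV i) * ι2 (eV i) = algebraMap ℝ _ (![0, 1, 1] i) := by
    rw [ι2_mul_self]
    congr 1
    fin_cases i <;> simp [Q201, eV, QuadraticMap.weightedSumSquares_apply, Fin.sum_univ_three]
  exact sandwich_of_anticommute (by simpa using hsq 0) (by simpa using hsq 1)
    (by simpa using hsq 2) (ι2_eV_mul_anticomm (by decide)) (ι2_eV_mul_anticomm (by decide))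
    (ι2_eV_mul_anticomm (by decide)) a₀ a₁ a₂ x y h

end
end

section
/- Work in the Clifford algebra Cl(2,0,1). For x₀, y₀ ∈ ℝ define the translator T := 1 + (y₀/2)·E₁ - (x₀/2)·E₂. Then T is a rotor (T · reverse(T) = 1) and for all x, y ∈ ℝ, T * P(x,y) * reverse(T) = P(x + x₀, y + y₀); that is, the sandwich X ↦ T X T̃ is the euclidean translation by the vector (x₀, y₀). -/
noncomputable section

theorem Q201_eV (i : Fin 3) : Q201 (eV i) = (![0, 1, 1] : Fin 3 → ℝ) i := by
  fin_cases i <;>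
    simp [Q201, eV, QuadraticMap.weightedSumSquares_apply, Fin.sum_univ_three]

theorem ι2_eV_zero_mul_self : ι2 (eV 0) * ι2 (eV 0) = 0 := by
  rw [ι2_mul_self, Q201_eV]
  exact map_zero _

theorem ι2_eV_one_mul_self : ι2 (eV 1) * ι2 (eV 1) = 1 := by
  rw [ι2_mul_self, Q201_eV]
  exact map_one _

theorem ι2_eV_two_mul_self : ι2 (eV 2) * ι2 (eV 2) = 1 := by
  rw [ι2_mul_self, Q201_eV]
  exact map_one _

/-- Distinct basis vectors anticommute. -/
theorem ι2_eV_mul_eV_of_ne {i j : Fin 3} (h : i ≠ j) :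
    ι2 (eV i) * ι2 (eV j) = -(ι2 (eV j) * ι2 (eV i)) := by
  refine CliffordAlgebra.ι_mul_ι_comm_of_isOrtho ?_
  rw [QuadraticMap.isOrtho_def]
  fin_cases i <;> fin_cases j <;>
    simp_all [Q201, eV, QuadraticMap.weightedSumSquares_apply, Fin.sum_univ_three]

theorem E₁_eq_neg : E₁ = -(ι2 (eV 0) * ι2 (eV 2)) := ι2_eV_mul_eV_of_ne (by decide)

theorem E₂_eq_neg : E₂ = -(ι2 (eV 1) * ι2 (eV 0)) := ι2_eV_mul_eV_of_ne (by decide)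

theorem E₀_eq_neg : E₀ = -(ι2 (eV 2) * ι2 (eV 1)) := ι2_eV_mul_eV_of_ne (by decide)

/-- Two bivectors sharing a middle vector multiply by contracting it. -/
theorem mul_mul_mul_of_mul_eq {A : Type*} [Semigroup A] {a b c d s : A} (h : b * c = s) :
    a * b * (c * d) = a * (s * d) := by
  rw [← h]; simp only [mul_assoc]

theorem E₁_mul_E₁ : E₁ * E₁ = 0 := by
  nth_rewrite 2 [E₁_eq_neg]
  rw [E₁, mul_neg, mul_mul_mul_of_mul_eq ι2_eV_zero_mul_self, zero_mul, mul_zero, neg_zero]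

theorem E₁_mul_E₂ : E₁ * E₂ = 0 := by
  rw [E₁, E₂, mul_mul_mul_of_mul_eq ι2_eV_zero_mul_self, zero_mul, mul_zero]

theorem E₂_mul_E₁ : E₂ * E₁ = 0 := by
  rw [E₁_eq_neg, E₂_eq_neg, neg_mul_neg, mul_mul_mul_of_mul_eq ι2_eV_zero_mul_self, zero_mul,
    mul_zero]

theorem E₂_mul_E₂ : E₂ * E₂ = 0 := by
  nth_rewrite 1 [E₂_eq_neg]
  rw [E₂, neg_mul, mul_mul_mul_of_mul_eq ι2_eV_zero_mul_self, zero_mul, mul_zero, neg_zero]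

theorem E₀_mul_E₁ : E₀ * E₁ = -E₂ := by
  rw [E₀, E₁, mul_mul_mul_of_mul_eq ι2_eV_two_mul_self, one_mul, E₂_eq_neg, neg_neg]

theorem E₁_mul_E₀ : E₁ * E₀ = E₂ := by
  rw [E₁_eq_neg, E₀_eq_neg, neg_mul_neg, mul_mul_mul_of_mul_eq ι2_eV_two_mul_self, one_mul, E₂]

theorem E₀_mul_E₂ : E₀ * E₂ = E₁ := by
  rw [E₀_eq_neg, E₂_eq_neg, neg_mul_neg, mul_mul_mul_of_mul_eq ι2_eV_one_mul_self, one_mul, E₁]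

theorem E₂_mul_E₀ : E₂ * E₀ = -E₁ := by
  rw [E₂, E₀, mul_mul_mul_of_mul_eq ι2_eV_one_mul_self, one_mul, E₁_eq_neg, neg_neg]

theorem reverse_E₁ : CliffordAlgebra.reverse E₁ = -E₁ := by
  rw [E₁_eq_neg, neg_neg, ← E₁_eq_neg, E₁, CliffordAlgebra.reverse.map_mul]
  simp only [ι2, CliffordAlgebra.reverse_ι]

theorem reverse_E₂ : CliffordAlgebra.reverse E₂ = -E₂ := by
  rw [E₂_eq_neg, neg_neg, ← E₂_eq_neg, E₂, CliffordAlgebra.reverse.map_mul]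
  simp only [ι2, CliffordAlgebra.reverse_ι]

/-- The translator `T = 1 + (y₀/2)E₁ - (x₀/2)E₂` is a rotor whose sandwich translates
every point by the vector `(x₀, y₀)`. -/
theorem translator_is_translation (x₀ y₀ : ℝ) :
    let T : CliffordAlgebra Q201 := 1 + (y₀ / 2) • E₁ - (x₀ / 2) • E₂
    T * CliffordAlgebra.reverse T = 1 ∧
      ∀ x y : ℝ, T * Pt x y * CliffordAlgebra.reverse T = Pt (x + x₀) (y + y₀) := by
  intro T
  have hT : CliffordAlgebra.reverse T = 1 - (y₀ / 2) • E₁ + (x₀ / 2) • E₂ := by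
    simp only [T, map_add, map_sub, map_smul, CliffordAlgebra.reverse.map_one, reverse_E₁,
      reverse_E₂]
    module
  rw [hT]
  refine ⟨?_, fun x y => ?_⟩
  · simp only [T, add_mul, sub_mul, mul_add, mul_sub, smul_mul_assoc, mul_smul_comm, one_mul,
      mul_one, E₁_mul_E₁, E₁_mul_E₂, E₂_mul_E₁, E₂_mul_E₂]
    module
  · simp only [T, Pt, add_mul, sub_mul, mul_add, mul_sub, neg_mul, zero_mul, smul_zero, smul_mul_assoc, mul_smul_comm,
      one_mul, mul_one, E₁_mul_E₁, E₁_mul_E₂, E₂_mul_E₁, E₂_mul_E₂, E₀_mul_E₁, E₀_mul_E₂,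
      E₁_mul_E₀, E₂_mul_E₀]
    module

end
end

section
/- Let A be a real Banach algebra, and let g, h, Π : ℝ → A be differentiable functions with g t * h t = 1 and h t * g t = 1 for all t, and suppose the function t ↦ g t * Π t * h t is constant (conservation of momentum in space). Then for every t, deriv Π t = Π t * Ω t - Ω t * Π t, where Ω(t) := h t * deriv g t. (These are the Euler equations of force-free rigid body motion in body coordinates: Π̇_c = 2 Π_c × Ω_c.) -/
/-- Euler equations for force-free rigid body motion in body coordinates: if the momentum
in space `g p g̃` is constant, then `ṗ = p Ω - Ω p` where `Ω = g̃ ġ` is the velocity in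
the body (i.e. `Π̇_c = 2 Π_c × Ω_c`). -/
theorem euler_equations {A : Type*} [NormedRing A] [NormedAlgebra ℝ A] [CompleteSpace A]
    (g h p : ℝ → A)
    (hg : Differentiable ℝ g) (hh : Differentiable ℝ h) (hp : Differentiable ℝ p)
    (hgh : ∀ t, g t * h t = 1) (hhg : ∀ t, h t * g t = 1)
    (hconst : ∀ s t, g s * p s * h s = g t * p t * h t) (t : ℝ) :
    deriv p t = p t * (h t * deriv g t) - (h t * deriv g t) * p t := by
  have momentum_mul : g * p = fun s => g t * p t * h t * g s := by
    funext s
    rw [Pi.mul_apply, ← hconst s t, mul_assoc (g s * p s), hhg, mul_one]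
  have hleft := (hg t).hasDerivAt.mul (hp t).hasDerivAt
  have hright := (hg t).hasDerivAt.const_mul (g t * p t * h t)
  have key : deriv g t * p t + g t * deriv p t = g t * p t * h t * deriv g t :=
    hleft.unique (momentum_mul ▸ hright)
  have cancel (x : A) : h t * (g t * x) = x := by rw [← mul_assoc, hhg, one_mul]
  have := congrArg (h t * ·) key
  simp only [mul_add, mul_assoc, cancel] at this
  rw [← this, mul_assoc, add_sub_cancel_left]
end

section
/- Let n ∈ ℕ and for i = 1,…,n let a planar force Fᵢ be given by an application point pᵢ = (pᵢ₁, pᵢ₂) ∈ ℝ² and a force vector vᵢ = (vᵢ₁, vᵢ₂) ∈ ℝ². In the exterior algebra ⋀(Fin 3 → ℝ), let H(Fᵢ) := ι(1, pᵢ₁, pᵢ₂) * ι(1, pᵢ₁ + vᵢ₁, pᵢ₂ + vᵢ₂) be the homogeneous form of Fᵢ. Then Σᵢ H(Fᵢ) = 0 if and only if Σᵢ vᵢ = 0 and Σᵢ (pᵢ₁·vᵢ₂ - pᵢ₂·vᵢ₁) = 0; that is, the system of forces is equivalent to the null force exactly when both the resultant force vector and the resultant moment about the origin vanish. -/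
namespace ExteriorAlgebra

/-- The homogeneous form of a planar force in Plücker coordinates. -/
theorem ι_point_mul_ι_point_add {R : Type*} [CommRing R] (x y a b : R) :
    ι R (M := Fin 3 → R) ![1, x, y] * ι R ![1, x + a, y + b] =
      a • (ι R ![1, 0, 0] * ι R ![0, 1, 0]) + b • (ι R ![1, 0, 0] * ι R ![0, 0, 1]) +
        (x * b - y * a) • (ι R ![0, 1, 0] * ι R ![0, 0, 1]) := by
  have hp : (![1, x, y] : Fin 3 → R) = ![1, 0, 0] + x • ![0, 1, 0] + y • ![0, 0, 1] := by
    ext i; fin_cases i <;> simp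
  have hq : (![1, x + a, y + b] : Fin 3 → R) =
      ![1, x, y] + (a • ![0, 1, 0] + b • ![0, 0, 1]) := by
    ext i; fin_cases i <;> simp
  have hswap : ι R (![0, 0, 1] : Fin 3 → R) * ι R ![0, 1, 0] =
      -(ι R ![0, 1, 0] * ι R ![0, 0, 1]) :=
    eq_neg_of_add_eq_zero_left (ι_add_mul_swap _ _)
  rw [hq, map_add, mul_add, ι_sq_zero, zero_add, hp]
  simp only [map_add, map_smul, add_mul, mul_add, smul_mul_assoc, mul_smul_comm, ι_sq_zero,
    hswap, smul_zero]
  module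

/-- The linear functional extending `u ∧ v ↦ det (w, u, v)` by zero in the other degrees. -/
noncomputable def detFunctional {R : Type*} [CommRing R] (w : Fin 3 → R) :
    ExteriorAlgebra R (Fin 3 → R) →ₗ[R] R :=
  liftAlternating (Pi.single 2 ((Matrix.detRowAlternating (n := Fin 3) (R := R)).curryLeft w))

theorem detFunctional_ι_mul_ι {R : Type*} [CommRing R] (w u v : Fin 3 → R) :
    detFunctional w (ι R u * ι R v) = (Matrix.of ![w, u, v]).det := by
  have h : ι R u * ι R v = ιMulti R 2 ![u, v] := by simp [ιMulti_apply]
  rw [h, detFunctional, liftAlternating_apply_ιMulti, Pi.single_eq_same]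
  rfl

/-- The basis bivectors of `⋀² R³` are linearly independent. -/
theorem bivector_eq_zero_iff {R : Type*} [CommRing R] (a b c : R) :
    a • (ι R (M := Fin 3 → R) ![1, 0, 0] * ι R ![0, 1, 0]) +
        b • (ι R ![1, 0, 0] * ι R ![0, 0, 1]) + c • (ι R ![0, 1, 0] * ι R ![0, 0, 1]) = 0 ↔
      a = 0 ∧ b = 0 ∧ c = 0 := by
  refine ⟨fun h => ?_, fun ⟨ha, hb, hc⟩ => by simp [ha, hb, hc]⟩
  have key (w : Fin 3 → R) := congrArg (detFunctional w) h
  simp only [map_add, map_smul, map_zero, detFunctional_ι_mul_ι] at key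
  refine ⟨?_, ?_, ?_⟩
  · simpa [Matrix.det_fin_three] using key ![0, 0, 1]
  · simpa [Matrix.det_fin_three] using key ![0, 1, 0]
  · simpa [Matrix.det_fin_three] using key ![1, 0, 0]

end ExteriorAlgebra

/-- Planar statics: a system of forces, with application points `p i` and force vectors
`v i`, has vanishing sum of homogeneous forms `H(Fᵢ) = ι(1,pᵢ) ∧ ι(1,pᵢ+vᵢ)` in the
exterior algebra of `ℝ³` iff the resultant force vector and the resultant moment about
the origin both vanish. -/
theorem force_system_equilibrium (n : ℕ) (p v : Fin n → ℝ × ℝ) :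
    (∑ i, ExteriorAlgebra.ι ℝ (M := Fin 3 → ℝ) ![1, (p i).1, (p i).2] *
        ExteriorAlgebra.ι ℝ ![1, (p i).1 + (v i).1, (p i).2 + (v i).2]) = 0 ↔
      ((∑ i, v i) = 0 ∧ (∑ i, ((p i).1 * (v i).2 - (p i).2 * (v i).1)) = 0) := by
  simp only [ExteriorAlgebra.ι_point_mul_ι_point_add, Finset.sum_add_distrib,
    ← Finset.sum_smul]
  rw [ExteriorAlgebra.bivector_eq_zero_iff, Prod.ext_iff, Prod.fst_sum, Prod.snd_sum, and_assoc]
  rfl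
end

section
/- For all real numbers x and y, the function ε ↦ ε · (arccos((ε + x·y) / √((ε + x²)·(ε + y²))))² tends to (x - y)² as ε → +∞. (Thus the squared euclidean distance between the points x and y on the line arises as the limit of the rescaled Cayley–Klein distance d̂²_ε = ε·d²_ε, where cos d_ε = ⟨X,Y⟩_ε / √(⟨X,X⟩_ε ⟨Y,Y⟩_ε) for the inner product ⟨X,Y⟩_ε = ε·x₀y₀ + x₁y₁ on homogeneous coordinates X = (1,x), Y = (1,y).) -/
open Filter

/-- The Cayley–Klein distance written as an arctangent. -/
lemma arccos_cayleyKlein_eq_arctan {x y ε : ℝ} (hε : 0 < ε) (h : 0 < ε + x * y) :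
    Real.arccos ((ε + x * y) / Real.sqrt ((ε + x ^ 2) * (ε + y ^ 2))) =
      Real.arctan (ε / (ε + x * y) * (|x - y| / Real.sqrt ε)) := by
  have hD : 0 < (ε + x ^ 2) * (ε + y ^ 2) := by positivity
  have hs : 0 < Real.sqrt ε := Real.sqrt_pos.2 hε
  have hS := Real.sqrt_pos.2 hD
  rw [Real.arccos_eq_arctan (div_pos h hS)]
  congr 1
  have h1 : 1 - ((ε + x * y) / Real.sqrt ((ε + x ^ 2) * (ε + y ^ 2))) ^ 2 =
      ε * (x - y) ^ 2 / ((ε + x ^ 2) * (ε + y ^ 2)) := by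
    rw [div_pow, Real.sq_sqrt hD.le]
    field_simp
    ring
  rw [h1, Real.sqrt_div (by positivity), Real.sqrt_mul hε.le, Real.sqrt_sq_eq_abs]
  field_simp
  rw [Real.sq_sqrt hε.le, mul_comm]

/-- The squared euclidean distance as a limit of rescaled Cayley–Klein distances:
`ε · (arccos((ε + xy)/√((ε + x²)(ε + y²))))² → (x - y)²` as `ε → ∞`. -/
theorem euclidean_distance_as_limit (x y : ℝ) :
    Tendsto (fun ε : ℝ =>
        ε * (Real.arccos ((ε + x * y) / Real.sqrt ((ε + x ^ 2) * (ε + y ^ 2)))) ^ 2)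
      atTop (nhds ((x - y) ^ 2)) := by
  have hadd : Tendsto (fun ε : ℝ => ε + x * y) atTop atTop :=
    tendsto_atTop_add_const_right _ _ tendsto_id
  have hr : Tendsto (fun ε : ℝ => ε / (ε + x * y)) atTop (nhds 1) := by
    have h : Tendsto (fun ε : ℝ => 1 - x * y / (ε + x * y)) atTop (nhds (1 - 0)) :=
      tendsto_const_nhds.sub (hadd.const_div_atTop _)
    rw [sub_zero] at h
    refine h.congr' ?_
    filter_upwards [hadd.eventually_gt_atTop 0] with ε hε
    field_simp
    ring
  have ht : Tendsto (fun ε : ℝ => ε / (ε + x * y) * (|x - y| / Real.sqrt ε)) atTop (nhds 0) := by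
    simpa using hr.mul (Real.tendsto_sqrt_atTop.const_div_atTop |x - y|)
  have hg : Tendsto (dslope Real.arctan 0) (nhds 0) (nhds 1) := by
    have h : ContinuousAt (dslope Real.arctan 0) 0 :=
      continuousAt_dslope_same.2 (Real.differentiableAt_arctan 0)
    simpa [ContinuousAt] using h
  have hlim := ((hr.pow 2).mul_const ((x - y) ^ 2)).mul ((hg.comp ht).pow 2)
  simp only [one_pow, one_mul, mul_one] at hlim
  refine hlim.congr' ?_
  filter_upwards [hadd.eventually_gt_atTop 0, eventually_gt_atTop 0] with ε h hε
  rw [arccos_cayleyKlein_eq_arctan hε h, Function.comp_apply]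
  set t := ε / (ε + x * y) * (|x - y| / Real.sqrt ε) with ht_def
  have hat : Real.arctan t = t * dslope Real.arctan 0 t := by
    simpa using (sub_smul_dslope Real.arctan 0 t).symm
  have hsq : ε * t ^ 2 = (ε / (ε + x * y)) ^ 2 * (x - y) ^ 2 := by
    rw [ht_def, mul_pow, div_pow |x - y|, Real.sq_sqrt hε.le, sq_abs]
    field_simp
  rw [hat, mul_pow, ← mul_assoc, hsq]
end
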